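/- arXiv:1304.7696 — 7 statements merged into one kernel-verified Lean document; each statement's English description precedes it below -/
import Mathlib

section
/- Let a > 0 and β > 0. The equation κ = (2/β)·tanh(κa) has a solution κ > 0 if and only if β < 2a. Moreover, when β < 2a, the positive solution is unique and satisfies κ < 2/β. -/
theorem Real.hasDerivAt_tanh (x : ℝ) : HasDerivAt Real.tanh (1 / Real.cosh x ^ 2) x := by
  have h := (Real.hasDerivAt_sinh x).div (Real.hasDerivAt_cosh x) (Real.cosh_pos x).ne'
  have hfun : Real.tanh = Real.sinh / Real.cosh :=
    funext fun y => Real.tanh_eq_sinh_div_cosh y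
  rw [hfun]
  exact h.congr_deriv (by rw [← Real.cosh_sq_sub_sinh_sq x]; ring)

theorem Real.continuous_tanh : Continuous Real.tanh :=
  continuous_iff_continuousAt.2 fun x => (Real.hasDerivAt_tanh x).continuousAt

theorem Real.strictConcaveOn_tanh : StrictConcaveOn ℝ (Set.Ici 0) Real.tanh := by
  refine StrictAntiOn.strictConcaveOn_of_deriv (convex_Ici 0) Real.continuous_tanh.continuousOn ?_
  rw [interior_Ici]
  intro x hx y hy hxy
  rw [(Real.hasDerivAt_tanh x).deriv, (Real.hasDerivAt_tanh y).deriv]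
  have hcosh : Real.cosh x < Real.cosh y :=
    Real.cosh_strictMonoOn (Set.mem_Ici.2 (Set.mem_Ioi.1 hx).le)
      (Set.mem_Ici.2 (Set.mem_Ioi.1 hy).le) hxy
  have hpos := Real.cosh_pos x
  gcongr

theorem Real.tanh_lt_self {x : ℝ} (hx : 0 < x) : Real.tanh x < x := by
  have h := Real.strictConcaveOn_tanh.slope_lt_of_hasDerivAt Set.self_mem_Ici hx.le hx
    (Real.hasDerivAt_tanh 0)
  simpa [slope_def_field, div_lt_one hx] using h

theorem Real.strictAntiOn_tanh_div_self : StrictAntiOn (fun x => Real.tanh x / x) (Set.Ioi 0) := by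
  intro x hx y hy hxy
  have h := Real.strictConcaveOn_tanh.secant_strict_mono (Set.self_mem_Ici (a := (0 : ℝ)))
    (Set.mem_Ici.2 (Set.mem_Ioi.1 hx).le) (Set.mem_Ici.2 (Set.mem_Ioi.1 hy).le)
    (Set.mem_Ioi.1 hx).ne' (Set.mem_Ioi.1 hy).ne' hxy
  simpa using h

theorem Real.exists_tanh_eq_mul {c : ℝ} (hc₀ : 0 < c) (hc₁ : c < 1) :
    ∃ x, 0 < x ∧ Real.tanh x = c * x := by
  have h := (Real.hasDerivAt_tanh 0).tendsto_slope.mono_left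
    (nhdsWithin_mono (0 : ℝ) fun x (hx : 0 < x) => hx.ne')
  have hev : ∀ᶠ x in nhdsWithin (0 : ℝ) (Set.Ioi 0), c < slope Real.tanh 0 x :=
    h.eventually_const_lt (by simpa using hc₁)
  obtain ⟨ε, hε, hε₀ : 0 < ε⟩ := (hev.and self_mem_nhdsWithin).exists
  have hlow : c * ε < Real.tanh ε := by
    simpa [slope_def_field, lt_div_iff₀ hε₀] using hε
  have hhigh : Real.tanh (1 / c) < c * (1 / c) := by
    simpa [hc₀.ne'] using Real.tanh_lt_one c⁻¹
  have hle : ε ≤ 1 / c := by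
    rw [le_div_iff₀ hc₀]
    linarith [Real.tanh_lt_one ε]
  obtain ⟨x, hx, hxeq⟩ := intermediate_value_Icc' hle
    (f := fun x => Real.tanh x - c * x)
    (Real.continuous_tanh.sub (continuous_const.mul continuous_id)).continuousOn
    (show (0 : ℝ) ∈ _ from ⟨by linarith, by linarith⟩)
  exact ⟨x, hε₀.trans_le hx.1, sub_eq_zero.1 hxeq⟩

/-- For `a > 0` and `β > 0`, the spectral condition `κ = (2/β)·tanh(κa)` has a positive
solution `κ` iff `β < 2a`; moreover, for `β < 2a` the positive solution is unique and
every positive solution satisfies `κ < 2/β`. -/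
theorem delta_prime_dirichlet_spectral_condition (a β : ℝ) (ha : 0 < a) (hβ : 0 < β) :
    ((∃ κ : ℝ, 0 < κ ∧ κ = 2 / β * Real.tanh (κ * a)) ↔ β < 2 * a) ∧
    (β < 2 * a → (∃! κ : ℝ, 0 < κ ∧ κ = 2 / β * Real.tanh (κ * a)) ∧
      ∀ κ : ℝ, 0 < κ → κ = 2 / β * Real.tanh (κ * a) → κ < 2 / β) := by
  have hexists : β < 2 * a → ∃ κ : ℝ, 0 < κ ∧ κ = 2 / β * Real.tanh (κ * a) := by
    intro hlt
    obtain ⟨x, hx, hxeq⟩ := Real.exists_tanh_eq_mul (c := β / (2 * a)) (by positivity)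
      ((div_lt_one (by positivity)).2 hlt)
    refine ⟨x / a, by positivity, ?_⟩
    rw [div_mul_cancel₀ x ha.ne', hxeq]
    field_simp
  have hratio : ∀ κ : ℝ, 0 < κ → κ = 2 / β * Real.tanh (κ * a) →
      Real.tanh (κ * a) / (κ * a) = β / (2 * a) := by
    intro κ hκ heq
    have hmul : κ * β = 2 * Real.tanh (κ * a) := by
      rw [div_mul_eq_mul_div, eq_div_iff hβ.ne'] at heq
      exact heq
    rw [div_eq_div_iff (by positivity) (by positivity)]
    linear_combination -a * hmul
  refine ⟨⟨?_, hexists⟩, fun hlt => ⟨?_, ?_⟩⟩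
  · rintro ⟨κ, hκ, heq⟩
    have hx : 0 < κ * a := mul_pos hκ ha
    rw [← div_lt_one (by positivity), ← hratio κ hκ heq, div_lt_one hx]
    exact Real.tanh_lt_self hx
  · refine existsUnique_of_exists_of_unique (hexists hlt) ?_
    rintro κ₁ κ₂ ⟨hκ₁, heq₁⟩ ⟨hκ₂, heq₂⟩
    exact mul_right_cancel₀ ha.ne' <| Real.strictAntiOn_tanh_div_self.injOn
      (mul_pos hκ₁ ha) (mul_pos hκ₂ ha) ((hratio κ₁ hκ₁ heq₁).trans (hratio κ₂ hκ₂ heq₂).symm)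
  · intro κ _ heq
    rw [heq]
    exact mul_lt_of_lt_one_right (by positivity) (Real.tanh_lt_one _)
end

section
/- Let a > 0, β > 0, γ ∈ ℝ and κ > 0. The following are equivalent: (i) there exists a function f : ℝ → ℝ, not identically zero on (−a,a)∖{0}, which is twice continuously differentiable on each of the closed intervals [−a,0] and [0,a] (with one-sided limits f(0⁻), f(0⁺) and one-sided derivatives f'(0⁻), f'(0⁺) at 0), satisfies f''(x) = κ²·f(x) for all x ∈ (−a,0) ∪ (0,a), the Dirichlet conditions f(−a) = f(a) = 0, and the coupling conditions f'(0⁻) = f'(0⁺) = −β⁻¹(f(0⁺) − f(0⁻)) + (γ/2)(f(0⁺) + f(0⁻)); (ii) κ = (2/β)·tanh(κa). -/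
open Set in
theorem mul_exp_eq_of_deriv_eq_const_mul {g g' : ℝ → ℝ} {p q c : ℝ}
    (hg : ∀ x, HasDerivAt g (g' x) x) (h : ∀ x ∈ Icc p q, g' x = c * g x)
    {x : ℝ} (hx : x ∈ Icc p q) :
    g x * Real.exp (-c * x) = g p * Real.exp (-c * p) := by
  have hd (t : ℝ) : HasDerivAt (fun t => g t * Real.exp (-c * t))
      (g' t * Real.exp (-c * t) + g t * (Real.exp (-c * t) * (-c))) t := by
    simpa using (hg t).fun_mul (((hasDerivAt_id t).const_mul (-c)).exp)
  refine constant_of_has_deriv_right_zero (f := fun t => g t * Real.exp (-c * t))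
    (fun t _ => (hd t).continuousAt.continuousWithinAt) (fun t ht => ?_) x hx
  have hzero : g' t * Real.exp (-c * t) + g t * (Real.exp (-c * t) * (-c)) = 0 := by
    rw [h t (Ico_subset_Icc_self ht)]; ring
  exact hzero ▸ (hd t).hasDerivWithinAt

open Set in
/-- A solution of `f'' = κ² f` on `(p, q)`, `C²` up to the boundary, that vanishes at `y ∈ [p, q]`
is a multiple of `sinh (κ (x - y))`. -/
theorem eq_sinh_and_deriv_eq_cosh_of_deriv_deriv_eq {f : ℝ → ℝ} {p q κ : ℝ} (hpq : p < q)
    (hκ : κ ≠ 0) (hf : ContDiff ℝ 2 f)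
    (h : ∀ x ∈ Ioo p q, deriv (deriv f) x = κ ^ 2 * f x)
    {x y : ℝ} (hx : x ∈ Icc p q) (hy : y ∈ Icc p q) (hfy : f y = 0) :
    f x = deriv f y / κ * Real.sinh (κ * (x - y)) ∧
      deriv f x = deriv f y * Real.cosh (κ * (x - y)) := by
  have hf' : ContDiff ℝ 1 (deriv f) := hf.deriv'
  have hd (t : ℝ) : HasDerivAt f (deriv f t) t :=
    (hf.differentiable (by norm_num)).differentiableAt.hasDerivAt
  have hdd (t : ℝ) : HasDerivAt (deriv f) (deriv (deriv f) t) t :=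
    (hf'.differentiable (by norm_num)).differentiableAt.hasDerivAt
  have hode : ∀ t ∈ Icc p q, deriv (deriv f) t = κ ^ 2 * f t := by
    rw [← closure_Ioo hpq.ne]
    exact EqOn.closure (f := deriv (deriv f)) (g := fun t => κ ^ 2 * f t) h
      (hf'.continuous_deriv le_rfl) (continuous_const.mul hf.continuous)
  have first_integral (c : ℝ) (hc : c ^ 2 = κ ^ 2) :
      deriv f x + c * f x = deriv f y * Real.exp (c * (x - y)) := by
    have key {t : ℝ} (ht : t ∈ Icc p q) :=
      mul_exp_eq_of_deriv_eq_const_mul (g := fun t => deriv f t + c * f t)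
        (fun t => (hdd t).add ((hd t).const_mul c)) (c := c)
        (fun t ht => by rw [hode t ht, ← hc]; ring) ht
    have hxy := (key hx).trans (key hy).symm
    simp only [hfy, mul_zero, add_zero] at hxy
    have hexp : Real.exp (-c * y) = Real.exp (c * (x - y)) * Real.exp (-c * x) := by
      rw [← Real.exp_add]; ring_nf
    rw [hexp, ← mul_assoc] at hxy
    exact mul_right_cancel₀ (Real.exp_pos _).ne' hxy
  have h₁ := first_integral κ rfl
  have h₂ := first_integral (-κ) (by ring)
  rw [neg_mul κ (x - y)] at h₂
  rw [Real.sinh_eq, Real.cosh_eq]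
  constructor
  · field_simp
    linear_combination (h₁ - h₂)
  · linear_combination (h₁ + h₂) / 2

/-- `−κ²` (with `κ > 0`) is an eigenvalue of the transverse operator `f ↦ −f''` on
`(−a,0) ∪ (0,a)` with Dirichlet conditions at `±a` and δ'-type coupling conditions
`f'(0⁻) = f'(0⁺) = −β⁻¹(f(0⁺) − f(0⁻)) + (γ/2)(f(0⁺) + f(0⁻))` at the origin, iff
`κ = (2/β)·tanh(κa)`.  A function on `(−a,a)∖{0}` which is twice continuously
differentiable up to the boundary on each of `[−a,0]` and `[0,a]` is encoded by a pair
of `C²` functions `fm, fp : ℝ → ℝ` giving its two halves; then `f(0⁻) = fm 0`,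
`f(0⁺) = fp 0`, `f'(0⁻) = fm' 0`, `f'(0⁺) = fp' 0`. -/
theorem transverse_dirichlet_eigenvalue_iff
    (a β γ κ : ℝ) (ha : 0 < a) (hβ : 0 < β) (hκ : 0 < κ) :
    (∃ fm fp : ℝ → ℝ, ContDiff ℝ 2 fm ∧ ContDiff ℝ 2 fp ∧
      (∀ x ∈ Set.Ioo (-a) 0, deriv (deriv fm) x = κ ^ 2 * fm x) ∧
      (∀ x ∈ Set.Ioo 0 a, deriv (deriv fp) x = κ ^ 2 * fp x) ∧
      fm (-a) = 0 ∧ fp a = 0 ∧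
      deriv fm 0 = deriv fp 0 ∧
      deriv fp 0 = -β⁻¹ * (fp 0 - fm 0) + γ / 2 * (fp 0 + fm 0) ∧
      ¬ ((∀ x ∈ Set.Ioo (-a) 0, fm x = 0) ∧ (∀ x ∈ Set.Ioo 0 a, fp x = 0))) ↔
    κ = 2 / β * Real.tanh (κ * a) := by
  have hC : 0 < Real.cosh (κ * a) := Real.cosh_pos _
  rw [Real.tanh_eq_sinh_div_cosh]
  constructor
  · rintro ⟨fm, fp, hm, hp, hmode, hpode, hma, hpa, hd, hc, hne⟩
    have hna : -a < 0 := by linarith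
    have solm {x : ℝ} (hx : x ∈ Set.Icc (-a) 0) :=
      eq_sinh_and_deriv_eq_cosh_of_deriv_deriv_eq hna hκ.ne' hm hmode hx
        (Set.left_mem_Icc.2 hna.le) hma
    have solp {x : ℝ} (hx : x ∈ Set.Icc 0 a) :=
      eq_sinh_and_deriv_eq_cosh_of_deriv_deriv_eq ha hκ.ne' hp hpode hx
        (Set.right_mem_Icc.2 ha.le) hpa
    obtain ⟨hm0, hm0'⟩ := solm (Set.right_mem_Icc.2 hna.le)
    obtain ⟨hp0, hp0'⟩ := solp (Set.left_mem_Icc.2 ha.le)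
    simp only [sub_neg_eq_add, zero_add, zero_sub, mul_neg, Real.sinh_neg, Real.cosh_neg]
      at hm0 hm0' hp0 hp0'
    have hend : deriv fm (-a) = deriv fp a :=
      mul_right_cancel₀ hC.ne' (by rw [← hm0', ← hp0', hd])
    have hB : deriv fp a ≠ 0 := fun hB => hne
      ⟨fun x hx => by simp [(solm (Set.Ioo_subset_Icc_self hx)).1, hend, hB],
        fun x hx => by simp [(solp (Set.Ioo_subset_Icc_self hx)).1, hB]⟩
    rw [hp0', hp0, hm0, hend] at hc
    field_simp at hc ⊢
    linarith
  · intro h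
    have hsinh (d x : ℝ) : HasDerivAt (fun x => Real.sinh (κ * (x + d)))
        (Real.cosh (κ * (x + d)) * κ) x := by
      simpa using (((hasDerivAt_id x).add_const d).const_mul κ).sinh
    have hcosh (d x : ℝ) : HasDerivAt (fun x => Real.cosh (κ * (x + d)) * κ)
        (κ ^ 2 * Real.sinh (κ * (x + d))) x := by
      refine (((((hasDerivAt_id x).add_const d).const_mul κ).cosh).mul_const κ).congr_deriv ?_
      simp only [id_eq, mul_one]; ring
    have hderiv (d : ℝ) : deriv (fun x => Real.sinh (κ * (x + d))) =
        fun x => Real.cosh (κ * (x + d)) * κ := funext fun x => (hsinh d x).deriv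
    have hsmooth (d : ℝ) : ContDiff ℝ 2 (fun x => Real.sinh (κ * (x + d))) := by
      fun_prop
    refine ⟨fun x => Real.sinh (κ * (x + a)), fun x => Real.sinh (κ * (x + -a)),
      hsmooth _, hsmooth _, fun x _ => ?_, fun x _ => ?_, by simp, by simp, ?_, ?_, ?_⟩
    · rw [hderiv]; exact (hcosh _ x).deriv
    · rw [hderiv]; exact (hcosh _ x).deriv
    · rw [hderiv, hderiv]; simp
    · rw [hderiv]
      simp only [zero_add, mul_neg, Real.sinh_neg, Real.cosh_neg]
      field_simp at h ⊢
      linarith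
    · rintro ⟨hzero, -⟩
      have hsinh_zero := hzero (-a / 2) ⟨by linarith, by linarith⟩
      have hpos : 0 < κ * (-a / 2 + a) := mul_pos hκ (by linarith)
      exact hpos.ne' (Real.sinh_eq_zero.1 hsinh_zero)
end

section
/- Let a > 0, β > 0, γ₊ ≥ 0, γ ∈ ℝ and κ > 0, and set Z = (κ − γ₊)/(κ + γ₊). The following are equivalent: (i) there exists a function f : ℝ → ℝ, not identically zero on (−a,a)∖{0}, twice continuously differentiable on each of [−a,0] and [0,a] (with one-sided limits f(0⁻), f(0⁺) and one-sided derivatives f'(0⁻), f'(0⁺) at 0), satisfying f''(x) = κ²·f(x) on (−a,0) ∪ (0,a), the Robin conditions f'(−a) = γ₊·f(−a) and f'(a) = −γ₊·f(a), and the coupling conditions f'(0⁻) = f'(0⁺) = −β⁻¹(f(0⁺) − f(0⁻)) + (γ/2)(f(0⁺) + f(0⁻)); (ii) κ·(1 − Z·e^{−2κa}) = (2/β)·(1 + Z·e^{−2κa}). -/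
/-- A `C²` solution of `f'' = k² f` on an open interval has `(f' - k f) e^{kx}` constant on the
closed interval. -/
theorem deriv_sub_mul_exp_eq_of_deriv_deriv_eq {f : ℝ → ℝ} {k l u : ℝ}
    (hf : ContDiff ℝ 2 f) (hode : ∀ x ∈ Set.Ioo l u, deriv (deriv f) x = k ^ 2 * f x)
    {x : ℝ} (hx : x ∈ Set.Icc l u) {y : ℝ} (hy : y ∈ Set.Icc l u) :
    (deriv f x - k * f x) * Real.exp (k * x) = (deriv f y - k * f y) * Real.exp (k * y) := by
  have hf1 : Differentiable ℝ f := hf.differentiable (by norm_num)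
  have hf2 : ContDiff ℝ 1 (deriv f) := by
    rw [show (2 : WithTop ℕ∞) = 1 + 1 by norm_num] at hf
    exact (contDiff_succ_iff_deriv.1 hf).2.2
  have hf3 : Differentiable ℝ (deriv f) := hf2.differentiable (by norm_num)
  set g : ℝ → ℝ := fun t => (deriv f t - k * f t) * Real.exp (k * t) with hg
  have hgd : ∀ t, HasDerivAt g ((deriv (deriv f) t - k ^ 2 * f t) * Real.exp (k * t)) t := by
    intro t
    have h := ((hf3 t).hasDerivAt.sub ((hf1 t).hasDerivAt.const_mul k)).mul
      ((hasDerivAt_id t).const_mul k).exp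
    refine h.congr_deriv ?_
    simp only [Pi.sub_apply, id]
    ring
  have hconst : ∀ t ∈ Set.Icc l u, g t = g l := by
    intro t ht
    rcases ht.1.eq_or_lt with rfl | hlt
    · rfl
    obtain ⟨c, hc, hc'⟩ := exists_hasDerivAt_eq_slope g _ hlt
      (fun s _ => (hgd s).continuousAt.continuousWithinAt) (fun s _ => hgd s)
    rw [hode c ⟨hc.1, hc.2.trans_le ht.2⟩, sub_self, zero_mul, eq_comm, div_eq_zero_iff] at hc'
    rcases hc' with h | h <;> linarith
  exact (hconst x hx).trans (hconst y hy).symm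

/-- A solution of `f'' = k² f` with zero Cauchy data at one point vanishes identically. -/
theorem eq_zero_of_deriv_deriv_eq {f : ℝ → ℝ} {k l u : ℝ} (hk : k ≠ 0)
    (hf : ContDiff ℝ 2 f) (hode : ∀ x ∈ Set.Ioo l u, deriv (deriv f) x = k ^ 2 * f x)
    {y : ℝ} (hy : y ∈ Set.Icc l u) (h0 : f y = 0) (h1 : deriv f y = 0)
    {x : ℝ} (hx : x ∈ Set.Icc l u) : f x = 0 := by
  have e1 := deriv_sub_mul_exp_eq_of_deriv_deriv_eq hf hode hx hy
  have e2 := deriv_sub_mul_exp_eq_of_deriv_deriv_eq (k := -k) hf (by simpa using hode) hx hy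
  simp only [h0, h1, mul_zero, sub_self, zero_mul, mul_eq_zero, (Real.exp_pos _).ne',
    or_false] at e1 e2
  have : k * f x = 0 := by linarith
  exact (mul_eq_zero.1 this).resolve_left hk

theorem hasDerivAt_exp_combination (A B k x : ℝ) :
    HasDerivAt (fun t => A * Real.exp (k * t) + B * Real.exp (-k * t))
      (k * A * Real.exp (k * x) + -k * B * Real.exp (-k * x)) x := by
  have h := (((hasDerivAt_id x).const_mul k).exp.const_mul A).add
    (((hasDerivAt_id x).const_mul (-k)).exp.const_mul B)
  refine h.congr_deriv ?_
  simp only [id]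
  ring

theorem deriv_exp_combination (A B k : ℝ) :
    deriv (fun t => A * Real.exp (k * t) + B * Real.exp (-k * t)) =
      fun t => k * A * Real.exp (k * t) + -k * B * Real.exp (-k * t) :=
  funext fun x => (hasDerivAt_exp_combination A B k x).deriv

/-- `−κ²` (with `κ > 0`) is an eigenvalue of the transverse operator `f ↦ −f''` on
`(−a,0) ∪ (0,a)` with Robin conditions `f'(−a) = γ₊ f(−a)`, `f'(a) = −γ₊ f(a)` and
δ'-type coupling conditions
`f'(0⁻) = f'(0⁺) = −β⁻¹(f(0⁺) − f(0⁻)) + (γ/2)(f(0⁺) + f(0⁻))` at the origin, iff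
`κ(1 − Z e^{−2κa}) = (2/β)(1 + Z e^{−2κa})` where `Z = (κ − γ₊)/(κ + γ₊)`.
A function on `(−a,a)∖{0}`, twice continuously differentiable up to the boundary on
each of `[−a,0]` and `[0,a]`, is encoded by a pair of `C²` functions `fm, fp : ℝ → ℝ`
giving its two halves; then `f(0⁻) = fm 0`, `f(0⁺) = fp 0`, etc. -/
theorem transverse_robin_eigenvalue_iff
    (a β γp γ κ Z : ℝ) (ha : 0 < a) (hβ : 0 < β) (hγp : 0 ≤ γp) (hκ : 0 < κ)
    (hZ : Z = (κ - γp) / (κ + γp)) :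
    (∃ fm fp : ℝ → ℝ, ContDiff ℝ 2 fm ∧ ContDiff ℝ 2 fp ∧
      (∀ x ∈ Set.Ioo (-a) 0, deriv (deriv fm) x = κ ^ 2 * fm x) ∧
      (∀ x ∈ Set.Ioo 0 a, deriv (deriv fp) x = κ ^ 2 * fp x) ∧
      deriv fm (-a) = γp * fm (-a) ∧ deriv fp a = -γp * fp a ∧
      deriv fm 0 = deriv fp 0 ∧
      deriv fp 0 = -β⁻¹ * (fp 0 - fm 0) + γ / 2 * (fp 0 + fm 0) ∧
      ¬ ((∀ x ∈ Set.Ioo (-a) 0, fm x = 0) ∧ (∀ x ∈ Set.Ioo 0 a, fp x = 0))) ↔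
    κ * (1 - Z * Real.exp (-2 * κ * a)) = 2 / β * (1 + Z * Real.exp (-2 * κ * a)) := by
  have hs : 0 < κ + γp := by linarith
  have hZs : Z * (κ + γp) = κ - γp := by rw [hZ]; field_simp
  have hZ1 : Z ≤ 1 := by rw [hZ, div_le_one hs]; linarith
  have hZ2 : -1 ≤ Z := by rw [hZ, le_div_iff₀ hs]; linarith
  set q := Real.exp (-κ * a) with hq
  have hq0 : 0 < q := Real.exp_pos _
  have hq1 : q < 1 := Real.exp_lt_one_iff.2 (by nlinarith)
  have hqq : Real.exp (-2 * κ * a) = q ^ 2 := by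
    rw [hq, ← Real.exp_nat_mul]; congr 1; push_cast; ring
  have hqp : Real.exp (κ * a) * q = 1 := by
    rw [hq, ← Real.exp_add]; simp
  rw [hqq]
  set p := Real.exp (κ * a) with hp
  have hq2 : q ^ 2 < 1 := by nlinarith
  set E := Z * q ^ 2 with hE
  have hEs : E * (κ + γp) * p = (κ - γp) * q := by
    rw [← hZs, hE]; linear_combination Z * q * (κ + γp) * hqp
  have hE1 : E < 1 := by nlinarith
  have hE2 : -1 < E := by nlinarith
  constructor
  · rintro ⟨fm, fp, hfm, hfp, om, op, rm, rp, hd, hc, hne⟩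
    have ha' : -a < 0 := by linarith
    have m1 := deriv_sub_mul_exp_eq_of_deriv_deriv_eq hfm om
      (Set.right_mem_Icc.2 ha'.le) (Set.left_mem_Icc.2 ha'.le)
    have m2 := deriv_sub_mul_exp_eq_of_deriv_deriv_eq (k := -κ) hfm (by simpa using om)
      (Set.right_mem_Icc.2 ha'.le) (Set.left_mem_Icc.2 ha'.le)
    have p1 := deriv_sub_mul_exp_eq_of_deriv_deriv_eq hfp op
      (Set.left_mem_Icc.2 ha.le) (Set.right_mem_Icc.2 ha.le)
    have p2 := deriv_sub_mul_exp_eq_of_deriv_deriv_eq (k := -κ) hfp (by simpa using op)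
      (Set.left_mem_Icc.2 ha.le) (Set.right_mem_Icc.2 ha.le)
    rw [mul_neg, ← neg_mul, ← hq] at m1
    rw [neg_mul_neg, ← hp] at m2
    rw [← hp] at p1
    rw [← hq] at p2
    simp only [mul_zero, Real.exp_zero, mul_one, rm, rp, hd] at m1 m2 p1 p2
    have em : deriv fp 0 * (1 + E) = κ * fm 0 * (1 - E) := by
      linear_combination m1 + E * m2 + fm (-a) * hEs
    have ep : deriv fp 0 * (1 + E) = -κ * fp 0 * (1 - E) := by
      linear_combination p2 + E * p1 - fp a * hEs
    have hodd : fm 0 = -fp 0 := by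
      have : κ * (1 - E) ≠ 0 := (mul_pos hκ (by linarith)).ne'
      apply mul_left_cancel₀ this
      linarith
    rw [hodd] at hc
    have hfp0 : fp 0 ≠ 0 := by
      intro h0
      have hd0 : deriv fp 0 = 0 := by rw [hc, h0]; simp
      refine hne ⟨fun x hx => ?_, fun x hx => ?_⟩
      · exact eq_zero_of_deriv_deriv_eq hκ.ne' hfm om (Set.right_mem_Icc.2 ha'.le)
          (by rw [hodd, h0, neg_zero]) (hd.trans hd0) (Set.Ioo_subset_Icc_self hx)
      · exact eq_zero_of_deriv_deriv_eq hκ.ne' hfp op (Set.left_mem_Icc.2 ha.le)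
          h0 hd0 (Set.Ioo_subset_Icc_self hx)
    apply mul_left_cancel₀ hfp0
    rw [div_eq_mul_inv]
    linear_combination ep - (1 + E) * hc
  · intro h
    refine ⟨fun x => -1 * Real.exp (κ * x) + -E * Real.exp (-κ * x),
      fun x => E * Real.exp (κ * x) + 1 * Real.exp (-κ * x), by fun_prop, by fun_prop,
      ?_, ?_, ?_, ?_, ?_, ?_, ?_⟩
    · intro x _
      rw [deriv_exp_combination, deriv_exp_combination]
      ring
    · intro x _
      rw [deriv_exp_combination, deriv_exp_combination]
      ring
    · simp only [deriv_exp_combination]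
      rw [neg_mul_neg κ a, mul_neg κ a, ← neg_mul κ a, ← hp, ← hq]
      linear_combination hEs
    · simp only [deriv_exp_combination]
      rw [← hp, ← hq]
      linear_combination hEs
    · simp only [deriv_exp_combination, mul_zero, Real.exp_zero]
      ring
    · simp only [deriv_exp_combination, mul_zero, Real.exp_zero]
      rw [div_eq_mul_inv] at h
      linear_combination -h
    · rintro ⟨-, h0⟩
      have hx := h0 (a / 2) ⟨by linarith, by linarith⟩
      set r := Real.exp (-κ * (a / 2)) with hr
      have hr0 : 0 < r := Real.exp_pos _
      have hrq : r ^ 2 = q := by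
        rw [hr, hq, ← Real.exp_nat_mul]; congr 1; push_cast; ring
      have hrp : Real.exp (κ * (a / 2)) * r = 1 := by
        rw [hr, ← Real.exp_add]; simp
      have hEq : E + q = 0 := by
        linear_combination r * hx - E * hrp - hrq
      nlinarith
end

section
/- Let a > 0, γ₊ ≥ 0 and β > 0 with β·γ₊ < 2. Then there exists exactly one κ > 0 satisfying κ·(1 − Z·e^{−2κa}) = (2/β)·(1 + Z·e^{−2κa}), where Z = (κ − γ₊)/(κ + γ₊); moreover, this solution satisfies κ > 2/β. -/
/-- The spectral condition with denominators and the decaying exponential cleared. -/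
theorem spectral_condition_iff_mul_exp {a g b k : ℝ} (hg : 0 ≤ g) (hk : 0 < k) :
    k * (1 - (k - g) / (k + g) * Real.exp (-2 * k * a)) =
        b * (1 + (k - g) / (k + g) * Real.exp (-2 * k * a)) ↔
      (k - b) * (k + g) * Real.exp (2 * k * a) = (k + b) * (k - g) := by
  have hkg : k + g ≠ 0 := by positivity
  have hE := Real.exp_ne_zero (2 * k * a)
  rw [show -2 * k * a = -(2 * k * a) by ring, Real.exp_neg]
  field_simp
  constructor <;> intro h <;> linear_combination h

theorem lt_of_spectral_condition {a g b k : ℝ} (ha : 0 < a) (hg : 0 ≤ g) (hgb : g < b)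
    (hk : 0 < k) (h : (k - b) * (k + g) * Real.exp (2 * k * a) = (k + b) * (k - g)) :
    b < k := by
  by_contra! hkb
  have hE : 1 ≤ Real.exp (2 * k * a) := Real.one_le_exp (by positivity)
  have h1 : 0 ≤ (b - k) * (k + g) := mul_nonneg (by linarith) (by linarith)
  nlinarith [mul_nonneg h1 (sub_nonneg.2 hE), mul_pos hk (sub_pos.2 hgb)]

theorem spectral_condition_not_lt {a g b k l : ℝ} (ha : 0 < a) (hg : 0 ≤ g) (hgb : g < b)
    (hbk : b < k) (h : (k - b) * (k + g) * Real.exp (2 * k * a) = (k + b) * (k - g))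
    (h' : (l - b) * (l + g) * Real.exp (2 * l * a) = (l + b) * (l - g)) : ¬ k < l := by
  intro hkl
  have hk : 0 < k := by linarith
  have hl : 0 < l := by linarith
  have key : ∀ x : ℝ, 0 < x →
      (x - b) * (x + g) * Real.exp (2 * x * a) = (x + b) * (x - g) →
      (Real.exp (2 * x * a) - 1) * (x + g - b - b * g / x) = 2 * (b - g) := by
    intro x hx h
    field_simp
    linear_combination h
  have hE : Real.exp (2 * k * a) < Real.exp (2 * l * a) := Real.exp_lt_exp.2 (by gcongr)
  have hE1 : 1 < Real.exp (2 * k * a) := Real.one_lt_exp_iff.2 (by positivity)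
  have hD : k + g - b - b * g / k ≤ l + g - b - b * g / l := by
    have : b * g / l ≤ b * g / k :=
      div_le_div_of_nonneg_left (mul_nonneg (by linarith) hg) hk hkl.le
    linarith
  have hDk : 0 < k + g - b - b * g / k := by
    have : k + g - b - b * g / k = (k - b) * (k + g) / k := by field_simp; ring
    rw [this]
    exact div_pos (mul_pos (by linarith) (by linarith)) hk
  have := mul_lt_mul (sub_lt_sub_right hE 1) hD hDk (by linarith)
  linarith [key k hk h, key l hl h']

theorem exists_spectral_condition {a g b : ℝ} (ha : 0 < a) (hg : 0 ≤ g) (hgb : g < b) :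
    ∃ k, 0 < k ∧ (k - b) * (k + g) * Real.exp (2 * k * a) = (k + b) * (k - g) := by
  have hb : 0 < b := by linarith
  have hc : 0 < 1 / a := by positivity
  have hcont : ContinuousOn
      (fun k : ℝ => (k - b) * (k + g) * Real.exp (2 * k * a) - (k + b) * (k - g))
      (Set.Icc b (b + 1 / a)) := by fun_prop
  have hleft : (b - b) * (b + g) * Real.exp (2 * b * a) - (b + b) * (b - g) ≤ 0 := by
    nlinarith [mul_pos hb (sub_pos.2 hgb)]
  have hright : 0 ≤ (b + 1 / a - b) * (b + 1 / a + g) * Real.exp (2 * (b + 1 / a) * a)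
      - (b + 1 / a + b) * (b + 1 / a - g) := by
    have hE := Real.add_one_le_exp (2 * (b + 1 / a) * a)
    have hac : a * (1 / a) = 1 := by field_simp
    generalize 1 / a = c at *
    have h1 := mul_le_mul_of_nonneg_left hE
      (mul_nonneg hc.le (by linarith : 0 ≤ b + c + g))
    have h2 : c * (b + c + g) * (2 * (b + c) * a + 1) - (b + c + b) * (b + c - g)
        = 2 * (b + c) * (c + 2 * g) := by
      linear_combination 2 * (b + c) * (b + c + g) * hac
    have h3 : 0 ≤ 2 * (b + c) * (c + 2 * g) := by positivity
    rw [add_sub_cancel_left]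
    linarith
  obtain ⟨k, hk, hk0⟩ := intermediate_value_Icc (by linarith) hcont ⟨hleft, hright⟩
  exact ⟨k, hb.trans_le hk.1, sub_eq_zero.1 hk0⟩

/-- For `a > 0`, `γ₊ ≥ 0` and `β > 0` with `βγ₊ < 2`, the spectral condition
`κ(1 − Z e^{−2κa}) = (2/β)(1 + Z e^{−2κa})`, `Z = (κ − γ₊)/(κ + γ₊)`, has exactly one
positive solution `κ`, and this solution satisfies `κ > 2/β`. -/
theorem transverse_robin_spectral_condition_unique
    (a γp β : ℝ) (ha : 0 < a) (hγp : 0 ≤ γp) (hβ : 0 < β) (h : β * γp < 2) :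
    (∃! κ : ℝ, 0 < κ ∧
      κ * (1 - (κ - γp) / (κ + γp) * Real.exp (-2 * κ * a)) =
        2 / β * (1 + (κ - γp) / (κ + γp) * Real.exp (-2 * κ * a))) ∧
    ∀ κ : ℝ, 0 < κ →
      κ * (1 - (κ - γp) / (κ + γp) * Real.exp (-2 * κ * a)) =
        2 / β * (1 + (κ - γp) / (κ + γp) * Real.exp (-2 * κ * a)) →
      2 / β < κ := by
  have hgb : γp < 2 / β := by
    rw [lt_div_iff₀ hβ]
    linarith
  refine ⟨?_, fun κ hκ hs =>
    lt_of_spectral_condition ha hγp hgb hκ ((spectral_condition_iff_mul_exp hγp hκ).1 hs)⟩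
  obtain ⟨k, hk, hks⟩ := exists_spectral_condition ha hγp hgb
  refine ⟨k, ⟨hk, (spectral_condition_iff_mul_exp hγp hk).2 hks⟩, fun l ⟨hl, hls⟩ => ?_⟩
  rw [spectral_condition_iff_mul_exp hγp hl] at hls
  exact le_antisymm
    (not_lt.1 (spectral_condition_not_lt ha hγp hgb
      (lt_of_spectral_condition ha hγp hgb hk hks) hks hls))
    (not_lt.1 (spectral_condition_not_lt ha hγp hgb
      (lt_of_spectral_condition ha hγp hgb hl hls) hls hks))
end

section
/- Let a > 0 and γ₊ ≥ 0. The function κ ↦ (1/κ)·(1 + Z(κ)·e^{−2κa})/(1 − Z(κ)·e^{−2κa}), where Z(κ) = (κ − γ₊)/(κ + γ₊), is strictly decreasing on the interval (γ₊, ∞). (Note that 0 ≤ Z(κ)·e^{−2κa} < 1 there, so the expression is well defined and positive.) -/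
/-- The Robin spectral quotient, written in terms of the Cayley transform of `E`. -/
theorem robin_quotient_eq_cayley {x g E : ℝ} (hg : 0 ≤ g) (hx : g < x) (hE : 0 < E)
    (hE1 : E < 1) :
    1 / x * ((1 + (x - g) / (x + g) * E) / (1 - (x - g) / (x + g) * E)) =
      (x + g * ((1 - E) / (1 + E))) / (x * (x * ((1 - E) / (1 + E)) + g)) := by
  have hx0 : 0 < x := hg.trans_lt hx
  have hxg : 0 < x + g := by positivity
  have hE2 : 0 < 1 + E := by positivity
  have hd : 0 < x + g - (x - g) * E := by nlinarith
  have hs : 0 < x * (1 - E) + g * (1 + E) := by linarith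
  have h₁ : (1 + (x - g) / (x + g) * E) / (1 - (x - g) / (x + g) * E) =
      (x * (1 + E) + g * (1 - E)) / (x * (1 - E) + g * (1 + E)) := by
    have e₁ : 1 + (x - g) / (x + g) * E = (x * (1 + E) + g * (1 - E)) / (x + g) := by
      field_simp; ring
    have e₂ : 1 - (x - g) / (x + g) * E = (x * (1 - E) + g * (1 + E)) / (x + g) := by
      field_simp; ring
    rw [e₁, e₂, div_div_div_cancel_right₀ hxg.ne']
  have h₂ : x + g * ((1 - E) / (1 + E)) = (x * (1 + E) + g * (1 - E)) / (1 + E) := by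
    field_simp
  have h₃ : x * (x * ((1 - E) / (1 + E)) + g) =
      x * (x * (1 - E) + g * (1 + E)) / (1 + E) := by
    field_simp
  rw [h₁, h₂, h₃, div_div_div_cancel_right₀ hE2.ne', div_mul_div_comm, one_mul]

theorem robin_quotient_lt {x y g s t : ℝ} (hg : 0 ≤ g) (hx : g < x) (hxy : x < y)
    (hs : 0 < s) (hst : s < t) :
    (y + g * t) / (y * (y * t + g)) < (x + g * s) / (x * (x * s + g)) := by
  have hx0 : 0 < x := hg.trans_lt hx
  have hy0 : 0 < y := hx0.trans hxy
  have ht : 0 < t := hs.trans hst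
  rw [div_lt_div_iff₀ (by positivity) (by positivity)]
  have hyg : 0 < y - g := by linarith
  have hyx : 0 < y - x := by linarith
  have hts : 0 < t - s := by linarith
  have h₁ : 0 < x * ((y - g) * (y + g)) * (t - s) := by positivity
  have h₂ : 0 < s * (y - x) * (x * y + g ^ 2) := by positivity
  have h₃ : 0 ≤ g * s * t * ((y - x) * (y + x)) := by positivity
  linarith

/-- For `a > 0` and `γ₊ ≥ 0`, the function
`κ ↦ (1/κ)·(1 + Z(κ)e^{−2κa})/(1 − Z(κ)e^{−2κa})` with `Z(κ) = (κ − γ₊)/(κ + γ₊)`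
is strictly decreasing on `(γ₊, ∞)`. -/
theorem robin_spectral_function_strictAntiOn (a γp : ℝ) (ha : 0 < a) (hγp : 0 ≤ γp) :
    StrictAntiOn (fun κ : ℝ =>
      1 / κ * ((1 + (κ - γp) / (κ + γp) * Real.exp (-2 * κ * a)) /
        (1 - (κ - γp) / (κ + γp) * Real.exp (-2 * κ * a))))
      (Set.Ioi γp) := by
  have exp_lt_one {κ : ℝ} (hκ : γp < κ) : Real.exp (-2 * κ * a) < 1 := by
    have : 0 < κ * a := mul_pos (hγp.trans_lt hκ) ha
    exact Real.exp_lt_one_iff.mpr (by linarith)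
  intro x hx y hy hxy
  rw [Set.mem_Ioi] at hx hy
  have hE1 := exp_lt_one hx
  have hE := Real.exp_pos (-2 * x * a)
  have hF := Real.exp_pos (-2 * y * a)
  have hFE : Real.exp (-2 * y * a) < Real.exp (-2 * x * a) :=
    Real.exp_lt_exp.mpr (by linarith [mul_lt_mul_of_pos_right hxy ha])
  simp only [robin_quotient_eq_cayley hγp hx hE hE1,
    robin_quotient_eq_cayley hγp hy hF (exp_lt_one hy)]
  refine robin_quotient_lt hγp hx hxy (div_pos (by linarith) (by linarith)) ?_
  exact div_lt_div₀ (by linarith) (by linarith) (by linarith) (by linarith)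
end

section
/- Let a > 0, γ₊ > 0, 0 < β < 2a, γ ∈ ℝ, and let λ be a real number with 0 ≤ λ < min{γ₊/(2a), (π/(4a))²}. Then there is no function f : ℝ → ℝ, not identically zero on (−a,a)∖{0}, which is twice continuously differentiable on each of the closed intervals [−a,0] and [0,a] (with one-sided limits f(0⁻), f(0⁺) and one-sided derivatives f'(0⁻), f'(0⁺) at 0) and satisfies −f''(x) = λ·f(x) on (−a,0) ∪ (0,a), the Robin conditions f'(−a) = γ₊·f(−a) and f'(a) = −γ₊·f(a), and the coupling conditions f'(0⁻) = f'(0⁺) = −β⁻¹(f(0⁺) − f(0⁻)) + (γ/2)(f(0⁺) + f(0⁻)). -/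
/-- A fundamental system `c, s` of `w'' = -lam w`, namely `cos (√lam x)` and
`sin (√lam x) / √lam`, with bounds at `a` when `√lam a < π / 4`. -/
theorem exists_fundamental_system_of_lt {a lam : ℝ} (ha : 0 < a) (hlam0 : 0 ≤ lam)
    (hlam : lam < (Real.pi / (4 * a)) ^ 2) :
    ∃ c s : ℝ → ℝ, (∀ x, HasDerivAt s (c x) x) ∧ (∀ x, HasDerivAt c (-lam * s x) x) ∧
      c 0 = 1 ∧ s 0 = 0 ∧ (∀ x, c x ^ 2 + lam * s x ^ 2 = 1) ∧
      1 / 2 < c a ∧ 0 ≤ s a ∧ s a ≤ a ∧ a * c a ≤ s a := by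
  rcases hlam0.eq_or_lt with rfl | hpos
  · refine ⟨fun _ => 1, fun x => x, fun x => hasDerivAt_id x, fun x => ?_, rfl, rfl,
      fun x => by norm_num, by norm_num, ha.le, le_rfl, by simp⟩
    simpa using hasDerivAt_const x (1 : ℝ)
  obtain ⟨k, hk, rfl⟩ : ∃ k : ℝ, 0 < k ∧ k ^ 2 = lam :=
    ⟨√lam, Real.sqrt_pos.2 hpos, Real.sq_sqrt hlam0⟩
  have hka0 : 0 < k * a := mul_pos hk ha
  have hka : k * a < Real.pi / 4 := by
    have h : k < Real.pi / (4 * a) := lt_of_pow_lt_pow_left₀ 2 (by positivity) hlam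
    rw [lt_div_iff₀ (by positivity)] at h
    linarith
  have hlin (x : ℝ) : HasDerivAt (fun y => k * y) k x := by
    simpa using (hasDerivAt_id x).const_mul k
  have hcos : 1 / 2 < Real.cos (k * a) := by
    rw [← Real.cos_pi_div_three]
    exact Real.cos_lt_cos_of_nonneg_of_le_pi hka0.le (by linarith [Real.pi_pos])
      (by linarith [Real.pi_pos])
  refine ⟨fun x => Real.cos (k * x), fun x => Real.sin (k * x) / k, fun x => ?_, fun x => ?_,
    by simp, by simp, fun x => ?_, hcos, ?_, ?_, ?_⟩
  · exact ((hlin x).sin.div_const k).congr_deriv (by field_simp)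
  · exact (hlin x).cos.congr_deriv (by field_simp)
  · rw [← Real.cos_sq_add_sin_sq (k * x)]
    field_simp
  · exact div_nonneg (Real.sin_nonneg_of_nonneg_of_le_pi hka0.le
      (by linarith [Real.pi_pos])) hk.le
  · rw [div_le_iff₀ hk]
    linarith [Real.sin_le hka0.le]
  · have h := Real.le_tan hka0.le (by linarith [Real.pi_pos])
    rw [Real.tan_eq_sin_div_cos, le_div_iff₀ (by linarith)] at h
    rw [le_div_iff₀ hk]
    linarith

/-- The Wronskian of two solutions of `w'' = -lam w` is constant. -/
theorem wronskian_eq_of_mem_Icc {a lam : ℝ} {u w w' : ℝ → ℝ} (hu : ContDiff ℝ 2 u)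
    (hode : ∀ x ∈ Set.Ioo 0 a, -deriv (deriv u) x = lam * u x)
    (hw : ∀ x, HasDerivAt w (w' x) x) (hw' : ∀ x, HasDerivAt w' (-lam * w x) x)
    {x : ℝ} (hx : x ∈ Set.Icc 0 a) :
    u x * w' x - deriv u x * w x = u 0 * w' 0 - deriv u 0 * w 0 := by
  have hu1 (y : ℝ) : HasDerivAt u (deriv u y) y :=
    (hu.differentiable (by norm_num) y).hasDerivAt
  have hu2 (y : ℝ) : HasDerivAt (deriv u) (deriv (deriv u) y) y :=
    ((hu.deriv' (n := 1)).differentiable (by norm_num) y).hasDerivAt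
  have hd (y : ℝ) := ((hu1 y).mul (hw' y)).sub ((hu2 y).mul (hw y))
  rcases hx.1.eq_or_lt with rfl | hx0
  · rfl
  obtain ⟨y, hy, h⟩ := exists_hasDerivAt_eq_slope _ _ hx0
    (fun y _ => (hd y).continuousAt.continuousWithinAt) fun y _ => hd y
  have hz := hode y ⟨hy.1, hy.2.trans_le hx.2⟩
  rw [eq_div_iff (by linarith)] at h
  simp only [Pi.sub_apply, Pi.mul_apply] at h
  linear_combination -h + (x - 0) * w y * hz

/-- The Dirichlet and Neumann data at `0` of a solution of `-u'' = lam u` on `(0, a)` with a Robin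
condition at `a` are proportional with a ratio `-C / S`, where `C / S > a`. -/
theorem exists_robin_to_neumann_ratio {a γp lam : ℝ} (ha : 0 < a) (hγp : 0 < γp)
    (hlam0 : 0 ≤ lam) (hlam : lam < min (γp / (2 * a)) ((Real.pi / (4 * a)) ^ 2)) :
    ∃ C S : ℝ, 0 < S ∧ a * S < C ∧ ∀ u : ℝ → ℝ, ContDiff ℝ 2 u →
      (∀ x ∈ Set.Ioo 0 a, -deriv (deriv u) x = lam * u x) → deriv u a = -γp * u a →
      S * u 0 = -C * deriv u 0 ∧
        (u 0 = 0 → deriv u 0 = 0 → ∀ x ∈ Set.Ioo 0 a, u x = 0) := by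
  obtain ⟨hlam1, hlam2⟩ := lt_min_iff.1 hlam
  obtain ⟨c, s, hs, hc, hc0, hs0, hcs, hca, hsa0, hsa, hle⟩ :=
    exists_fundamental_system_of_lt ha hlam0 hlam2
  rw [lt_div_iff₀ (by positivity)] at hlam1
  have hlams : lam * s a ≤ lam * a := mul_le_mul_of_nonneg_left hsa hlam0
  have hlams0 : 0 ≤ lam * s a := mul_nonneg hlam0 hsa0
  refine ⟨c a + γp * s a, γp * c a - lam * s a, ?_, ?_, fun u hu hode hrobin => ?_⟩
  · nlinarith
  · nlinarith [mul_le_mul_of_nonneg_left hle hγp.le, mul_nonneg ha.le hlams0]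
  have Wc (x : ℝ) (hx : x ∈ Set.Icc 0 a) := wronskian_eq_of_mem_Icc hu hode hc
    (fun y => (hs y).const_mul (-lam)) hx
  have Ws (x : ℝ) (hx : x ∈ Set.Icc 0 a) := wronskian_eq_of_mem_Icc hu hode hs hc hx
  simp only [hc0, hs0] at Wc Ws
  refine ⟨?_, fun h0 h1 x hx => ?_⟩
  · have h1 := Wc a ⟨ha.le, le_rfl⟩
    have h2 := Ws a ⟨ha.le, le_rfl⟩
    rw [hrobin] at h1 h2
    linear_combination (-(γp * c a - lam * s a)) * h2 + (c a + γp * s a) * h1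
  · have h1' := Wc x ⟨hx.1.le, hx.2.le⟩
    have h2 := Ws x ⟨hx.1.le, hx.2.le⟩
    rw [h0, h1] at h1' h2
    linear_combination c x * h2 - s x * h1' - u x * hcs x


/-- For `0 < β < 2a` the transverse operator `f ↦ −f''` on `(−a,0) ∪ (0,a)` with Robin
conditions `f'(−a) = γ₊ f(−a)`, `f'(a) = −γ₊ f(a)` and δ'-type coupling conditions
`f'(0⁻) = f'(0⁺) = −β⁻¹(f(0⁺) − f(0⁻)) + (γ/2)(f(0⁺) + f(0⁻))` at the origin has no
eigenvalue `λ` with `0 ≤ λ < min{γ₊/(2a), (π/(4a))²}`.  A function on `(−a,a)∖{0}`,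
twice continuously differentiable up to the boundary on each of `[−a,0]` and `[0,a]`,
is encoded by a pair of `C²` functions `fm, fp : ℝ → ℝ` giving its two halves; then
`f(0⁻) = fm 0`, `f(0⁺) = fp 0`, etc. -/
theorem transverse_robin_no_low_nonnegative_eigenvalue
    (a γp β γ lam : ℝ) (ha : 0 < a) (hγp : 0 < γp) (hβ : 0 < β) (hβa : β < 2 * a)
    (hlam0 : 0 ≤ lam) (hlam : lam < min (γp / (2 * a)) ((Real.pi / (4 * a)) ^ 2)) :
    ¬ ∃ fm fp : ℝ → ℝ, ContDiff ℝ 2 fm ∧ ContDiff ℝ 2 fp ∧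
      (∀ x ∈ Set.Ioo (-a) 0, -deriv (deriv fm) x = lam * fm x) ∧
      (∀ x ∈ Set.Ioo 0 a, -deriv (deriv fp) x = lam * fp x) ∧
      deriv fm (-a) = γp * fm (-a) ∧ deriv fp a = -γp * fp a ∧
      deriv fm 0 = deriv fp 0 ∧
      deriv fp 0 = -β⁻¹ * (fp 0 - fm 0) + γ / 2 * (fp 0 + fm 0) ∧
      ¬ ((∀ x ∈ Set.Ioo (-a) 0, fm x = 0) ∧ (∀ x ∈ Set.Ioo 0 a, fp x = 0)) := by
  rintro ⟨fm, fp, hfm, hfp, hodem, hodep, hrm, hrp, hN, hcoup, hne⟩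
  obtain ⟨C, S, hS, hCS, hu⟩ := exists_robin_to_neumann_ratio ha hγp hlam0 hlam
  have hd1 : deriv (fun x => fm (-x)) = fun x => -deriv fm (-x) :=
    funext fun x => deriv_comp_neg fm x
  have hd2 (x : ℝ) : deriv (deriv fun x => fm (-x)) x = deriv (deriv fm) (-x) := by
    rw [hd1, deriv.fun_neg, deriv_comp_neg (deriv fm) x, neg_neg]
  obtain ⟨hp, hp0⟩ := hu fp hfp hodep hrp
  obtain ⟨hm, hm0⟩ := hu (fun x => fm (-x)) (hfm.comp contDiff_neg)
    (fun x hx => by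
      rw [hd2]
      exact hodem (-x) ⟨by linarith [hx.2], by linarith [hx.1]⟩)
    (by
      rw [hd1]
      linear_combination -hrm)
  simp only [hd1, neg_zero, hN] at hm hm0
  have hsum : fp 0 + fm 0 = 0 :=
    (mul_eq_zero.1 (by linear_combination hp + hm : S * (fp 0 + fm 0) = 0)).resolve_left hS.ne'
  have hβd : β * deriv fp 0 = fm 0 - fp 0 := by
    rw [hcoup, hsum]
    field_simp
    ring
  have hd : deriv fp 0 = 0 := by
    refine (mul_eq_zero.1 (?_ : (2 * C - β * S) * deriv fp 0 = 0)).resolve_left ?_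
    · linear_combination hp - hm - S * hβd
    · nlinarith
  have hp00 : fp 0 = 0 := by simpa [hd, hS.ne'] using hp
  have hm00 : fm 0 = 0 := by simpa [hd, hS.ne'] using hm
  refine hne ⟨fun x hx => ?_, hp0 hp00 hd⟩
  simpa using hm0 hm00 (by rw [hd, neg_zero]) (-x) ⟨by linarith [hx.2], by linarith [hx.1]⟩
end

section
/- Let a > 0, γ₊ > 0 and k > 0 with k² < min{γ₊/(2a), (π/(4a))²}. Then ka < π/4, the quantity γ₊ − k·tan(ka) is strictly positive, and (1/k)·(γ₊·tan(ka) + k)/(γ₊ − k·tan(ka)) > a. In particular, for any β with 0 < β < 2a the spectral equation β/2 = (1/k)·(γ₊·tan(ka) + k)/(γ₊ − k·tan(ka)) has no solution k in this range. -/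
/-- On `(0, π/3]`, where `cos ≥ 1/2`, the tangent is below the line of slope two. -/
theorem Real.tan_lt_two_mul {x : ℝ} (hx : 0 < x) (hx' : x ≤ Real.pi / 3) :
    Real.tan x < 2 * x := by
  have hcos : 1 / 2 ≤ Real.cos x := by
    rw [← Real.cos_pi_div_three]
    exact Real.cos_le_cos_of_nonneg_of_le_pi hx.le (by linarith [Real.pi_pos]) hx'
  rw [Real.tan_eq_sin_div_cos, div_lt_iff₀ (by linarith)]
  nlinarith [Real.sin_lt hx]

/-- For `a > 0`, `γ₊ > 0` and `k > 0` with `k² < min{γ₊/(2a), (π/(4a))²}` one has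
`ka < π/4`, `γ₊ − k·tan(ka) > 0`, and `(1/k)·(γ₊ tan(ka) + k)/(γ₊ − k tan(ka)) > a`;
hence for `0 < β < 2a` the spectral equation
`β/2 = (1/k)·(γ₊ tan(ka) + k)/(γ₊ − k tan(ka))` has no solution `k` in this range. -/
theorem robin_positive_spectral_equation_no_small_solution
    (a γp k : ℝ) (ha : 0 < a) (hγp : 0 < γp) (hk : 0 < k)
    (hk2 : k ^ 2 < min (γp / (2 * a)) ((Real.pi / (4 * a)) ^ 2)) :
    k * a < Real.pi / 4 ∧
    0 < γp - k * Real.tan (k * a) ∧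
    a < 1 / k * ((γp * Real.tan (k * a) + k) / (γp - k * Real.tan (k * a))) ∧
    ∀ β : ℝ, 0 < β → β < 2 * a →
      β / 2 ≠ 1 / k * ((γp * Real.tan (k * a) + k) / (γp - k * Real.tan (k * a))) := by
  obtain ⟨h₁, h₂⟩ := lt_min_iff.1 hk2
  have hka : 0 < k * a := mul_pos hk ha
  have hlt : k * a < Real.pi / 4 := by
    have h := lt_of_pow_lt_pow_left₀ 2 (by positivity) h₂
    rw [lt_div_iff₀ (by positivity)] at h
    linarith
  have htan_lt : Real.tan (k * a) < 2 * (k * a) :=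
    Real.tan_lt_two_mul hka (by linarith [Real.pi_pos])
  have hlt_tan : k * a < Real.tan (k * a) := Real.lt_tan hka (by linarith [Real.pi_pos])
  have hden : 0 < γp - k * Real.tan (k * a) := by
    rw [lt_div_iff₀ (by positivity)] at h₁
    nlinarith
  have hbound :
      a < 1 / k * ((γp * Real.tan (k * a) + k) / (γp - k * Real.tan (k * a))) := by
    rw [one_div, ← div_eq_inv_mul, lt_div_iff₀ hk, lt_div_iff₀ hden]
    have hγ : γp * (k * a) < γp * Real.tan (k * a) := mul_lt_mul_of_pos_left hlt_tan hγp
    have hprod : 0 < k * a * (k * Real.tan (k * a)) :=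
      mul_pos hka (mul_pos hk (hka.trans hlt_tan))
    linarith
  exact ⟨hlt, hden, hbound, fun β _ hβ h => by linarith⟩
end
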